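/- Let Δ and Γ be Cohen-Macaulay simplicial complexes of the same dimension d on the vertex set [n]. If the intersection Δ ∩ Γ is Cohen-Macaulay of dimension d, then the union Δ ∪ Γ is Cohen-Macaulay of dimension d. -/

import Mathlib

open MvPolynomial CategoryTheory CategoryTheory.Limits

noncomputable section

/-- A simplicial complex on a vertex set `V`: a collection of finite subsets of `V`
closed under taking subsets. -/
def IsSimplicialComplex {V : Type} (Δ : Set (Finset V)) : Prop :=
  ∀ F ∈ Δ, ∀ G : Finset V, G ⊆ F → G ∈ Δ

/-- The dimension of a simplicial complex: `max {|F| - 1 : F ∈ Δ}`. -/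
def complexDim {V : Type} (Δ : Set (Finset V)) : ℤ :=
  sSup ((fun F : Finset V => (F.card : ℤ) - 1) '' Δ)

/-- The star of a face: `st_Δ(F) = {H ∈ Δ : H ∪ F ∈ Δ}`. -/
def complexStar {V : Type} [DecidableEq V] (Δ : Set (Finset V)) (F : Finset V) :
    Set (Finset V) :=
  {H | H ∈ Δ ∧ H ∪ F ∈ Δ}

/-- The facets (maximal faces) of a simplicial complex. -/
def facets {V : Type} (Δ : Set (Finset V)) : Set (Finset V) :=
  {F | F ∈ Δ ∧ ∀ G ∈ Δ, F ⊆ G → F = G}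

/-- The Stanley–Reisner ideal of a simplicial complex `Δ`:
generated by the squarefree monomials `∏_{i ∈ F} x_i` with `F ∉ Δ`. -/
def srIdeal (k : Type) [Field k] {V : Type} (Δ : Set (Finset V)) :
    Ideal (MvPolynomial V k) :=
  Ideal.span {m | ∃ F : Finset V, F ∉ Δ ∧ m = ∏ i ∈ F, X i}

/-- The face prime `P_F = (x_j : j ∉ F)`. -/
def facePrime (k : Type) [Field k] {V : Type} (F : Finset V) :
    Ideal (MvPolynomial V k) :=
  Ideal.span ((X : V → MvPolynomial V k) '' {j | j ∉ F})

/-- The `m`-th symbolic power of the Stanley–Reisner ideal: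
`I_Δ^{(m)} = ⋂_{F facet of Δ} P_F^m`. -/
def symbolicPower (k : Type) [Field k] {V : Type} (Δ : Set (Finset V)) (m : ℕ) :
    Ideal (MvPolynomial V k) :=
  ⨅ F ∈ facets Δ, (facePrime k F) ^ m

/-- The homogeneous maximal ideal `m = (x_1, …, x_n)` of the polynomial ring. -/
def maxIdeal (k : Type) [Field k] (V : Type) : Ideal (MvPolynomial V k) :=
  Ideal.span (Set.range (X : V → MvPolynomial V k))

/-- The `i`-th local cohomology module `H^i_m(S/I)`. -/
def locCoh (k : Type) [Field k] (V : Type) (I : Ideal (MvPolynomial V k)) (i : ℕ) :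
    ModuleCat (MvPolynomial V k) :=
  (localCohomology (maxIdeal k V) i).obj
    (ModuleCat.of (MvPolynomial V k) (MvPolynomial V k ⧸ I))

/-- `S/I` is Cohen–Macaulay: `H^i_m(S/I) = 0` for all `i < dim S/I`. -/
def quotCM (k : Type) [Field k] (V : Type) (I : Ideal (MvPolynomial V k)) : Prop :=
  ∀ i : ℕ, (i : WithBot (WithTop ℕ)) < ringKrullDim (MvPolynomial V k ⧸ I) →
    Subsingleton (locCoh k V I i)

/-- `S/I` is generalized Cohen–Macaulay: `H^i_m(S/I)` has finite length for all
`i < dim S/I`. -/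
def quotGCM (k : Type) [Field k] (V : Type) (I : Ideal (MvPolynomial V k)) : Prop :=
  ∀ i : ℕ, (i : WithBot (WithTop ℕ)) < ringKrullDim (MvPolynomial V k ⧸ I) →
    IsFiniteLength (MvPolynomial V k) (locCoh k V I i)

/-- `S/I` is `r`-Buchsbaum: `m^r · H^i_m(S/I) = 0` for all `i < dim S/I`. -/
def quotKBuchsbaum (k : Type) [Field k] (V : Type) (I : Ideal (MvPolynomial V k))
    (r : ℕ) : Prop :=
  ∀ i : ℕ, (i : WithBot (WithTop ℕ)) < ringKrullDim (MvPolynomial V k ⧸ I) →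
    ∀ x ∈ (maxIdeal k V) ^ r, ∀ y : locCoh k V I i, x • y = 0

/-- The canonical map `Ext^i_S(S/m, S/I) → H^i_m(S/I)`, realized as the colimit
injection at the first power of `m` in the direct system defining local cohomology. -/
def canonicalExtToLocCoh (k : Type) [Field k] (V : Type) (I : Ideal (MvPolynomial V k))
    (i : ℕ) :
    ((localCohomology.diagram (localCohomology.idealPowersDiagram (maxIdeal k V)) i).obj
        (Opposite.op (Opposite.op (1 : ℕ)))).obj
      (ModuleCat.of (MvPolynomial V k) (MvPolynomial V k ⧸ I)) ⟶ locCoh k V I i :=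
  letI := localCohomology.hasColimitDiagram.{0,0}
    (localCohomology.idealPowersDiagram (maxIdeal k V)) i
  (colimit.ι (localCohomology.diagram (localCohomology.idealPowersDiagram (maxIdeal k V)) i)
    (Opposite.op (Opposite.op (1 : ℕ)))).app (ModuleCat.of (MvPolynomial V k) (MvPolynomial V k ⧸ I))

/-- `S/I` is Buchsbaum: the canonical map `Ext^i_S(S/m, S/I) → H^i_m(S/I)` is
surjective for all `i < dim S/I`. -/
def quotBuchsbaum (k : Type) [Field k] (V : Type) (I : Ideal (MvPolynomial V k)) : Prop :=
  ∀ i : ℕ, (i : WithBot (WithTop ℕ)) < ringKrullDim (MvPolynomial V k ⧸ I) →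
    Function.Surjective (canonicalExtToLocCoh k V I i)

/-- A simplicial complex is Cohen–Macaulay if its Stanley–Reisner ring is
Cohen–Macaulay over every field. -/
def complexCM {V : Type} (Δ : Set (Finset V)) : Prop :=
  ∀ (k : Type) [Field k], quotCM k V (srIdeal k Δ)

/-- A simplicial complex is Buchsbaum if its Stanley–Reisner ring is Buchsbaum over
every field. -/
def complexBuchsbaum {V : Type} (Δ : Set (Finset V)) : Prop :=
  ∀ (k : Type) [Field k], quotBuchsbaum k V (srIdeal k Δ)

/-- The independence complex of a graph: faces are the independent sets. -/
def indepComplex {V : Type} (G : SimpleGraph V) : Set (Finset V) :=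
  {F | ∀ i ∈ F, ∀ j ∈ F, ¬ G.Adj i j}

/-- The edge ideal `I(G) = (x_i x_j : ij ∈ E(G))`. -/
def edgeIdeal (k : Type) [Field k] {V : Type} (G : SimpleGraph V) :
    Ideal (MvPolynomial V k) :=
  Ideal.span {m | ∃ i j : V, G.Adj i j ∧ m = X i * X j}

/-- The independence number `α(G)`. -/
def indepNumber {V : Type} (G : SimpleGraph V) : ℕ :=
  sSup {c | ∃ F ∈ indepComplex G, F.card = c}

/-- A graph is Cohen–Macaulay if its independence complex is. -/
def graphCM {V : Type} (G : SimpleGraph V) : Prop :=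
  complexCM (indepComplex G)

/-- The vertex set of the localization `G_{pq} = G \ (N(p) ∪ N(q))` of `G` at an
edge `pq`. -/
def edgeLocSet {V : Type} (G : SimpleGraph V) (p q : V) : Set V :=
  {v | v ∉ G.neighborSet p ∪ G.neighborSet q}

/-- The localization of `G` at an edge `pq`: the induced subgraph on the vertices not
adjacent to `p` or `q` (this removes `p` and `q` as well). -/
def edgeLoc {V : Type} (G : SimpleGraph V) (p q : V) :
    SimpleGraph (edgeLocSet G p q) :=
  G.induce (edgeLocSet G p q)

/-- `G` is special Cohen–Macaulay: `G` is Cohen–Macaulay and for every edge `pq`,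
`G_{pq}` is Cohen–Macaulay with `α(G_{pq}) = α(G) - 1`. -/
def specialCM {V : Type} (G : SimpleGraph V) : Prop :=
  graphCM G ∧ ∀ p q : V, G.Adj p q →
    graphCM (edgeLoc G p q) ∧ indepNumber (edgeLoc G p q) + 1 = indepNumber G

/-- The vertex set of `G_i = G \ ({i} ∪ N(i))`. -/
def vertexLocSet {V : Type} (G : SimpleGraph V) (i : V) : Set V :=
  {v | v ≠ i ∧ v ∉ G.neighborSet i}

/-- `G_i = G \ ({i} ∪ N(i))`: the induced subgraph obtained by deleting `i` and all
its neighbors. -/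
def vertexLoc {V : Type} (G : SimpleGraph V) (i : V) :
    SimpleGraph (vertexLocSet G i) :=
  G.induce (vertexLocSet G i)

/-- A graph is unmixed if all its maximal independent sets have the same cardinality. -/
def graphUnmixed {V : Type} (G : SimpleGraph V) : Prop :=
  ∀ F ∈ facets (indepComplex G), ∀ F' ∈ facets (indepComplex G), F.card = F'.card

/-- `G` has no isolated vertices. -/
def noIsolated {V : Type} (G : SimpleGraph V) : Prop :=
  ∀ v : V, ∃ w : V, G.Adj v w

end
section OppositeHomology

universe u v

variable {R : Type u} [Ring R] {ι : Type*} {c : ComplexShape ι}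

/-- The element `x` of `Kₙ`, viewed in `ModuleCat R`, is a cocycle with cohomology class `e`. -/
def RepresentsClass (K : HomologicalComplex (ModuleCat.{v} R)ᵒᵖ c) (n : ι)
    (x : (K.X n).unop) (e : (K.homology n).unop) : Prop :=
  ∃ z : (K.opcycles n).unop, (K.pOpcycles n).unop z = x ∧ (K.homologyι n).unop z = e

namespace RepresentsClass

variable {K L : HomologicalComplex (ModuleCat.{v} R)ᵒᵖ c} {n : ι}

lemma congr_class {x : (K.X n).unop} {e e' : (K.homology n).unop} (h : RepresentsClass K n x e)
    (he : e = e') : RepresentsClass K n x e' :=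
  he ▸ h

lemma exists_rep (e : (K.homology n).unop) : ∃ x, RepresentsClass K n x e := by
  obtain ⟨z, hz⟩ := (ModuleCat.epi_iff_surjective (K.homologyι n).unop).1 inferInstance e
  exact ⟨_, z, rfl, hz⟩

lemma d_eq_zero {x : (K.X n).unop} {e : (K.homology n).unop} (h : RepresentsClass K n x e)
    (m : ι) : (K.d m n).unop x = 0 := by
  obtain ⟨z, rfl, -⟩ := h
  have : (K.pOpcycles n).unop ≫ (K.d m n).unop = 0 := by
    rw [← unop_comp, K.d_pOpcycles, unop_zero]
  exact ConcreteCategory.congr_hom this z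

lemma exists_of_d_eq_zero (x : (K.X n).unop) (hx : (K.d (c.prev n) n).unop x = 0) :
    ∃ e, RepresentsClass K n x e := by
  have hS := (ShortComplex.exact_of_g_is_cokernel
    (ShortComplex.mk _ _ (K.d_pOpcycles (c.prev n) n)) (K.opcyclesIsCokernel _ n rfl)).unop
  obtain ⟨z, hz⟩ := (ShortComplex.moduleCat_exact_iff _).1 hS x hx
  exact ⟨_, z, hz, rfl⟩

lemma eq_zero_iff {x : (K.X n).unop} {e : (K.homology n).unop} (h : RepresentsClass K n x e) :
    e = 0 ↔ ∃ y, x = (K.d n (c.next n)).unop y := by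
  obtain ⟨z, rfl, rfl⟩ := h
  have hfac : (K.fromOpcycles n (c.next n)).unop ≫ (K.pOpcycles n).unop =
      (K.d n (c.next n)).unop := by
    rw [← unop_comp, K.p_fromOpcycles]
  have hinj := (ModuleCat.mono_iff_injective (K.pOpcycles n).unop).1 inferInstance
  have hS := (ShortComplex.exact_of_f_is_kernel
    (ShortComplex.mk _ _ (K.homologyι_comp_fromOpcycles n (c.next n)))
      (K.homologyIsKernel n _ rfl)).unop
  constructor
  · intro hz
    obtain ⟨y, hy⟩ := (ShortComplex.moduleCat_exact_iff _).1 hS z hz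
    refine ⟨y, ?_⟩
    rw [← hfac]
    exact congrArg (K.pOpcycles n).unop hy.symm
  · rintro ⟨y, hy⟩
    rw [← hfac] at hy
    obtain rfl := hinj hy
    exact ConcreteCategory.congr_hom
      (congrArg Quiver.Hom.unop (K.homologyι_comp_fromOpcycles n (c.next n))) y

lemma map {φ : K ⟶ L} {x : (L.X n).unop} {e : (L.homology n).unop}
    (h : RepresentsClass L n x e) :
    RepresentsClass K n ((φ.f n).unop x) ((HomologicalComplex.homologyMap φ n).unop e) := by
  obtain ⟨z, rfl, rfl⟩ := h
  refine ⟨(HomologicalComplex.opcyclesMap φ n).unop z, ?_, ?_⟩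
  · exact ConcreteCategory.congr_hom
      (congrArg Quiver.Hom.unop (HomologicalComplex.p_opcyclesMap φ n)) z
  · exact (ConcreteCategory.congr_hom
      (congrArg Quiver.Hom.unop (HomologicalComplex.homologyι_naturality φ n)) z).symm

end RepresentsClass

end OppositeHomology

section ExtClasses

universe u

variable {R : Type u} [CommRing R]

/-- The complex `Hom(P, Y)` whose homology computes `Ext(X, Y)`, in the opposite category. -/
abbrev homComplex {X : ModuleCat.{u} R} (P : ProjectiveResolution X) (Y : ModuleCat.{u} R) :
    ChainComplex (ModuleCat.{u} R)ᵒᵖ ℕ :=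
  (((linearYoneda R (ModuleCat.{u} R)).obj Y).rightOp.mapHomologicalComplex _).obj P.complex

/-- `Extⁿ(X, Y)` is the cohomology of `Hom(P, Y)` for any projective resolution `P` of `X`. -/
noncomputable def extIsoHomology {X : ModuleCat.{u} R} (P : ProjectiveResolution X) (n : ℕ)
    (Y : ModuleCat.{u} R) :
    ((Ext R (ModuleCat.{u} R) n).obj (Opposite.op X)).obj Y ≅
      ((homComplex P Y).homology n).unop :=
  (P.isoLeftDerivedObj ((linearYoneda R (ModuleCat.{u} R)).obj Y).rightOp n).unop.symm

/-- The cocycle `f : Pₙ ⟶ Y` has class `e` in `Extⁿ(X, Y)`. -/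
def RepresentsExt {X : ModuleCat.{u} R} (P : ProjectiveResolution X) (n : ℕ) (Y : ModuleCat.{u} R)
    (f : P.complex.X n ⟶ Y)
    (e : ((Ext R (ModuleCat.{u} R) n).obj (Opposite.op X)).obj Y) : Prop :=
  RepresentsClass (homComplex P Y) n f ((extIsoHomology P n Y).hom e)

namespace RepresentsExt

variable {X X' : ModuleCat.{u} R} {P : ProjectiveResolution X} {P' : ProjectiveResolution X'}
  {n : ℕ} {Y : ModuleCat.{u} R}

lemma exists_rep (P : ProjectiveResolution X)
    (e : ((Ext R (ModuleCat.{u} R) n).obj (Opposite.op X)).obj Y) :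
    ∃ f, RepresentsExt P n Y f e :=
  RepresentsClass.exists_rep (K := homComplex P Y) ((extIsoHomology P n Y).hom e)

lemma d_comp {f : P.complex.X n ⟶ Y}
    {e : ((Ext R (ModuleCat.{u} R) n).obj (Opposite.op X)).obj Y}
    (h : RepresentsExt P n Y f e) (m : ℕ) : P.complex.d m n ≫ f = 0 :=
  RepresentsClass.d_eq_zero h m

lemma exists_of_d_comp (f : P.complex.X n ⟶ Y) (hf : P.complex.d (n + 1) n ≫ f = 0) :
    ∃ e, RepresentsExt P n Y f e := by
  obtain ⟨e, he⟩ := RepresentsClass.exists_of_d_eq_zero (K := homComplex P Y) (n := n) f (by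
    have : (ComplexShape.down ℕ).prev n = n + 1 := by simp
    rw [this]; exact hf)
  exact ⟨(extIsoHomology P n Y).inv e, he.congr_class
    (ConcreteCategory.congr_hom (extIsoHomology P n Y).inv_hom_id e).symm⟩

lemma eq_zero_iff {f : P.complex.X n ⟶ Y}
    {e : ((Ext R (ModuleCat.{u} R) n).obj (Opposite.op X)).obj Y}
    (h : RepresentsExt P n Y f e) :
    e = 0 ↔ ∃ g, f = P.complex.d n ((ComplexShape.down ℕ).next n) ≫ g := by
  refine Iff.trans ?_ (RepresentsClass.eq_zero_iff h)
  exact (map_eq_zero_iff (extIsoHomology P n Y).hom.hom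
    ((ModuleCat.mono_iff_injective _).1 inferInstance)).symm

lemma map {f : P.complex.X n ⟶ Y}
    {e : ((Ext R (ModuleCat.{u} R) n).obj (Opposite.op X)).obj Y}
    (h : RepresentsExt P n Y f e) (w : X' ⟶ X) (φ : P'.complex ⟶ P.complex)
    (hφ : φ.f 0 ≫ P.π.f 0 = P'.π.f 0 ≫ w) :
    RepresentsExt P' n Y (φ.f n ≫ f) (((Ext R (ModuleCat.{u} R) n).map w.op).app Y e) := by
  refine (RepresentsClass.map (φ := (((linearYoneda R (ModuleCat.{u} R)).obj
    Y).rightOp.mapHomologicalComplex _).map φ) h).congr_class ?_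
  exact (ConcreteCategory.congr_hom (congrArg Quiver.Hom.unop
    (ProjectiveResolution.isoLeftDerivedObj_inv_naturality w P' P φ hφ
      ((linearYoneda R (ModuleCat.{u} R)).obj Y).rightOp n)) e).symm

end RepresentsExt

end ExtClasses
section LocalCohomologyVanishing

open Opposite

variable {R : Type} [CommRing R]

/-- The projective resolutions of the modules `R ⧸ J ^ t` used to compute local cohomology. -/
noncomputable def powerResolution (J : Ideal R) (t : ℕ) :
    ProjectiveResolution
      ((localCohomology.ringModIdeals (localCohomology.idealPowersDiagram J)).obj (op t)) :=
  projectiveResolution _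

/-- The augmentation of the resolution of `R ⧸ J ^ t`. -/
noncomputable def powerAugmentation (J : Ideal R) (t : ℕ) :
    (powerResolution J t).complex.X 0 ⟶
      (localCohomology.ringModIdeals (localCohomology.idealPowersDiagram J)).obj (op t) :=
  (powerResolution J t).π.f 0

/-- The chain map `φ` between the resolutions of `R ⧸ J ^ t'` and `R ⧸ J ^ t` lifts the
quotient map. -/
def LiftsQuotientMap (J : Ideal R) {t t' : ℕ} (h : t ≤ t')
    (φ : (powerResolution J t').complex ⟶ (powerResolution J t).complex) : Prop :=
  φ.f 0 ≫ powerAugmentation J t = powerAugmentation J t' ≫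
    (localCohomology.ringModIdeals (localCohomology.idealPowersDiagram J)).map (homOfLE h).op

lemma LiftsQuotientMap.comp {J : Ideal R} {t t' t'' : ℕ} {h : t ≤ t'} {h' : t' ≤ t''}
    {φ : (powerResolution J t').complex ⟶ (powerResolution J t).complex}
    {ψ : (powerResolution J t'').complex ⟶ (powerResolution J t').complex}
    (hφ : LiftsQuotientMap J h φ) (hψ : LiftsQuotientMap J h' ψ) :
    LiftsQuotientMap J (h.trans h') (ψ ≫ φ) := by
  unfold LiftsQuotientMap at *
  rw [HomologicalComplex.comp_f, Category.assoc, hφ, reassoc_of% hψ, ← Functor.map_comp]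
  rfl

/-- Every cocycle of degree `i` with values in `M` becomes a coboundary at a higher power. -/
def CocyclesVanish (J : Ideal R) (i : ℕ) (M : ModuleCat.{0} R) : Prop :=
  ∀ (t : ℕ) (f : (powerResolution J t).complex.X i ⟶ M),
    (powerResolution J t).complex.d (i + 1) i ≫ f = 0 →
    ∃ (t' : ℕ) (h : t ≤ t') (φ : (powerResolution J t').complex ⟶ (powerResolution J t).complex)
      (g : (powerResolution J t').complex.X ((ComplexShape.down ℕ).next i) ⟶ M),
      LiftsQuotientMap J h φ ∧ φ.f i ≫ f = (powerResolution J t').complex.d i _ ≫ g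

lemma subsingleton_localCohomology_iff (J : Ideal R) (i : ℕ) (M : ModuleCat.{0} R) :
    Subsingleton ((localCohomology J i).obj M) ↔ CocyclesVanish J i M := by
  let D := localCohomology.diagram (localCohomology.idealPowersDiagram J) i
  let E := (evaluation (ModuleCat.{0} R) (ModuleCat.{0} R)).obj M
  have := localCohomology.hasColimitDiagram.{0, 0} (localCohomology.idealPowersDiagram J) i
  let hc : IsColimit (E.mapCocone (colimit.cocone D)) :=
    isColimitOfPreserves E (colimit.isColimit D)
  constructor
  · intro hs t f hf
    obtain ⟨e, he⟩ := RepresentsExt.exists_of_d_comp (P := powerResolution J t) f hf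
    have h0 : (E.mapCocone (colimit.cocone D)).ι.app (op (op t)) e =
        (E.mapCocone (colimit.cocone D)).ι.app (op (op t)) 0 := hs.elim _ _
    obtain ⟨⟨⟨t'⟩⟩, a, b, hab⟩ := Concrete.isColimit_exists_of_rep_eq.{0} (D ⋙ E) hc _ _ h0
    have h : t ≤ t' := leOfHom a.unop.unop
    let φ := ProjectiveResolution.lift
      ((localCohomology.ringModIdeals (localCohomology.idealPowersDiagram J)).map (homOfLE h).op)
      (powerResolution J t') (powerResolution J t)
    have hφ : LiftsQuotientMap J h φ := ProjectiveResolution.lift_commutes_zero _ _ _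
    have hz := (he.map _ φ hφ).eq_zero_iff.1 (hab.trans (map_zero _))
    obtain ⟨g, hg⟩ := hz
    exact ⟨t', h, φ, g, hφ, hg⟩
  · intro H
    refine ⟨fun x y => ?_⟩
    suffices ∀ x : E.obj (colimit D), x = 0 from (this x).trans (this y).symm
    intro x
    obtain ⟨⟨⟨t⟩⟩, e, rfl⟩ := Concrete.isColimit_exists_rep (D ⋙ E) hc x
    obtain ⟨f, hf⟩ := RepresentsExt.exists_rep (powerResolution J t) e
    obtain ⟨t', h, φ, g, hφ, hg⟩ := H t f (hf.d_comp _)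
    have hz := (hf.map _ φ hφ).eq_zero_iff.2 ⟨g, hg⟩
    have hw := (E.mapCocone (colimit.cocone D)).w (homOfLE h).op.op
    rw [← hw]
    refine Eq.trans ?_ (map_zero
      ((E.mapCocone (colimit.cocone D)).ι.app (op (op t'))).hom)
    exact congrArg ((E.mapCocone (colimit.cocone D)).ι.app (op (op t'))) hz

lemma CocyclesVanish.prod {J : Ideal R} {i : ℕ} {M N : ModuleCat.{0} R}
    (hM : CocyclesVanish J i M) (hN : CocyclesVanish J i N) :
    CocyclesVanish J i (ModuleCat.of R (M × N)) := by
  intro t f hf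
  let p : ModuleCat.of R (M × N) ⟶ M := ModuleCat.ofHom (LinearMap.fst R M N)
  let q : ModuleCat.of R (M × N) ⟶ N := ModuleCat.ofHom (LinearMap.snd R M N)
  obtain ⟨t', h, φ, g, hφ, hg⟩ := hM t (f ≫ p) (by rw [reassoc_of% hf, zero_comp])
  obtain ⟨t'', h', ψ, k, hψ, hk⟩ := hN t' (φ.f i ≫ f ≫ q) (by
    rw [← HomologicalComplex.Hom.comm_assoc, reassoc_of% hf, zero_comp, comp_zero])
  refine ⟨t'', h.trans h', ψ ≫ φ,
    ModuleCat.ofHom ((ψ.f _ ≫ g).hom.prod k.hom), hφ.comp hψ, ?_⟩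
  ext x
  have hg' := ConcreteCategory.congr_hom (ψ.f i ≫= hg) x
  rw [HomologicalComplex.Hom.comm_assoc] at hg'
  · exact hg'
  · exact ConcreteCategory.congr_hom hk x

/-- Vanishing in the long exact sequence: if `Hⁱ(M₂) = 0` and `Hⁱ⁻¹(M₃) = 0` then
`Hⁱ(M₁) = 0`. -/
lemma CocyclesVanish.of_shortExact {J : Ideal R} {i : ℕ} {S : ShortComplex (ModuleCat.{0} R)}
    (hS : S.ShortExact) (h₂ : CocyclesVanish J i S.X₂)
    (h₃ : ∀ j, j + 1 = i → CocyclesVanish J j S.X₃) : CocyclesVanish J i S.X₁ := by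
  have := hS.mono_f
  have := hS.epi_g
  intro t f hf
  obtain ⟨t', h, φ, g, hφ, hg⟩ := h₂ t (f ≫ S.f) (by rw [reassoc_of% hf, zero_comp])
  rcases i with _ | j
  · refine ⟨t', h, φ, 0, hφ, ?_⟩
    rw [← cancel_mono S.f, Category.assoc, hg, HomologicalComplex.shape _ _ _ (by simp)]
    simp
  · generalize hn : (ComplexShape.down ℕ).next (j + 1) = m at g hg
    obtain rfl : m = j := by simpa using hn.symm
    obtain ⟨t'', h', ψ, k, hψ, hk⟩ := h₃ m rfl t' (g ≫ S.g) (by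
      rw [← reassoc_of% hg, S.zero, comp_zero, comp_zero])
    let k' := Projective.factorThru k S.g
    let u := hS.exact.lift (ψ.f m ≫ g - (powerResolution J t'').complex.d m _ ≫ k') (by
      rw [Preadditive.sub_comp, Category.assoc, Category.assoc, Projective.factorThru_comp, hk,
        sub_self])
    have hu : u ≫ S.f = ψ.f m ≫ g - (powerResolution J t'').complex.d m _ ≫ k' :=
      hS.exact.lift_f _ _
    refine ⟨t'', h.trans h', ψ ≫ φ, u, hφ.comp hψ, ?_⟩
    rw [← cancel_mono S.f, Category.assoc, Category.assoc, hu, Preadditive.comp_sub,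
      HomologicalComplex.d_comp_d_assoc, zero_comp, sub_zero, HomologicalComplex.comp_f,
      Category.assoc, hg, HomologicalComplex.Hom.comm_assoc]

end LocalCohomologyVanishing
section StanleyReisner

variable {k : Type} [Field k] {V : Type}

lemma prod_X_eq_monomial (F : Finset V) :
    (∏ i ∈ F, X i : MvPolynomial V k) = monomial (∑ i ∈ F, Finsupp.single i 1) 1 := by
  rw [monomial_sum_one]
  rfl

lemma mem_srIdeal_iff {Δ : Set (Finset V)} (hΔ : IsSimplicialComplex Δ) (p : MvPolynomial V k) :
    p ∈ srIdeal k Δ ↔ ∀ m ∈ p.support, m.support ∉ Δ := by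
  classical
  have h : {m : MvPolynomial V k | ∃ F : Finset V, F ∉ Δ ∧ m = ∏ i ∈ F, X i} =
      (fun s => monomial s (1 : k)) '' ((fun F => ∑ i ∈ F, Finsupp.single i 1) '' Δᶜ) := by
    ext m
    simp [prod_X_eq_monomial, eq_comm]
  rw [srIdeal, h, mem_ideal_span_monomial_image]
  refine forall₂_congr fun m _ => ?_
  simp only [Set.exists_mem_image, Set.mem_compl_iff]
  have happ (F : Finset V) (j : V) :
      (∑ i ∈ F, Finsupp.single i 1 : V →₀ ℕ) j = if j ∈ F then 1 else 0 := by
    simp [Finsupp.finsetSum_apply, Finsupp.single_apply]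
  constructor
  · rintro ⟨F, hF, hle⟩ hm
    refine hF (hΔ _ hm _ fun i hi => ?_)
    have := hle i
    rw [happ, if_pos hi] at this
    exact Finsupp.mem_support_iff.2 (by omega)
  · refine fun hm => ⟨_, hm, fun j => ?_⟩
    rw [happ]
    split_ifs with hj
    · exact Nat.one_le_iff_ne_zero.2 (Finsupp.mem_support_iff.1 hj)
    · exact Nat.zero_le _

lemma IsSimplicialComplex.union {Δ Γ : Set (Finset V)} (hΔ : IsSimplicialComplex Δ)
    (hΓ : IsSimplicialComplex Γ) : IsSimplicialComplex (Δ ∪ Γ) :=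
  fun F hF G hG => hF.imp (fun h => hΔ F h G hG) (fun h => hΓ F h G hG)

lemma IsSimplicialComplex.inter {Δ Γ : Set (Finset V)} (hΔ : IsSimplicialComplex Δ)
    (hΓ : IsSimplicialComplex Γ) : IsSimplicialComplex (Δ ∩ Γ) :=
  fun F hF G hG => hF.imp (fun h => hΔ F h G hG) (fun h => hΓ F h G hG)

lemma srIdeal_union {Δ Γ : Set (Finset V)} (hΔ : IsSimplicialComplex Δ)
    (hΓ : IsSimplicialComplex Γ) : srIdeal k (Δ ∪ Γ) = srIdeal k Δ ⊓ srIdeal k Γ := by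
  ext p
  simp only [Submodule.mem_inf, mem_srIdeal_iff hΔ, mem_srIdeal_iff hΓ,
    mem_srIdeal_iff (hΔ.union hΓ), Set.mem_union, not_or, forall_and]

lemma srIdeal_inter (Δ Γ : Set (Finset V)) :
    srIdeal k (Δ ∩ Γ) = srIdeal k Δ ⊔ srIdeal k Γ := by
  rw [srIdeal, srIdeal, srIdeal, ← Ideal.span_union]
  congr 1
  ext m
  simp only [Set.mem_inter_iff, not_and_or, Set.mem_ofPred_eq, Set.mem_union, or_and_right,
    exists_or]

lemma srIdeal_le_facePrime {Δ : Set (Finset V)} (hΔ : IsSimplicialComplex Δ) {F : Finset V}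
    (hF : F ∈ Δ) : srIdeal k Δ ≤ facePrime k F := by
  rw [srIdeal, Ideal.span_le]
  rintro _ ⟨G, hG, rfl⟩
  obtain ⟨i, hiG, hiF⟩ := Finset.not_subset.1 fun h => hG (hΔ F hF G h)
  exact Ideal.mem_of_dvd _ (Finset.dvd_prod_of_mem _ hiG)
    (Ideal.subset_span ⟨i, hiF, rfl⟩)

lemma exists_facePrime_le [Fintype V] {Δ : Set (Finset V)} {P : Ideal (MvPolynomial V k)}
    [hP : P.IsPrime] (h : srIdeal k Δ ≤ P) : ∃ F ∈ Δ, facePrime k F ≤ P := by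
  classical
  refine ⟨Finset.univ.filter fun i => (X i : MvPolynomial V k) ∉ P, ?_, ?_⟩
  · by_contra hF
    have h1 := h (Ideal.subset_span ⟨_, hF, rfl⟩)
    obtain ⟨i, hi, hiP⟩ := hP.prod_mem_iff.1 h1
    exact (Finset.mem_filter.1 hi).2 hiP
  · rw [facePrime, Ideal.span_le]
    rintro _ ⟨i, hi, rfl⟩
    simpa using hi

lemma ringKrullDim_mvPolynomial_coe (F : Finset V) :
    ringKrullDim (MvPolynomial F k) = F.card := by
  rw [MvPolynomial.ringKrullDim_of_isNoetherianRing, ringKrullDim_eq_zero_of_field]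
  simp

lemma ringKrullDim_quotient_facePrime (F : Finset V) :
    ringKrullDim (MvPolynomial V k ⧸ facePrime k F) = F.card := by
  classical
  rw [← ringKrullDim_mvPolynomial_coe (k := k) F]
  apply le_antisymm
  · let g : MvPolynomial F k →ₐ[k] MvPolynomial V k ⧸ facePrime k F :=
      (Ideal.Quotient.mkₐ k _).comp (rename Subtype.val)
    refine ringKrullDim_le_of_surjective g.toRingHom ?_
    have hr : g.range = ⊤ := by
      rw [eq_top_iff, ← (AlgHom.range_eq_top _).2 (Ideal.Quotient.mkₐ_surjective k (facePrime k F)),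
        ← Algebra.map_top, ← adjoin_range_X, AlgHom.map_adjoin, Algebra.adjoin_le_iff]
      rintro _ ⟨_, ⟨i, rfl⟩, rfl⟩
      by_cases hi : i ∈ F
      · exact ⟨X ⟨i, hi⟩, by simp [g]⟩
      · have : Ideal.Quotient.mkₐ k (facePrime k F) (X i) = 0 :=
          Ideal.Quotient.eq_zero_iff_mem.2 (Ideal.subset_span ⟨i, hi, rfl⟩)
        exact this ▸ g.range.zero_mem
    exact (AlgHom.range_eq_top g).1 hr
  · let g : MvPolynomial V k →ₐ[k] MvPolynomial F k :=
      aeval fun i => if h : i ∈ F then X ⟨i, h⟩ else 0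
    have hg : ∀ a ∈ facePrime k F, g.toRingHom a = 0 := by
      suffices facePrime k F ≤ RingHom.ker g.toRingHom from this
      rw [facePrime, Ideal.span_le]
      rintro _ ⟨i, hi, rfl⟩
      have hi' : i ∉ F := hi
      simp [g, hi']
    refine ringKrullDim_le_of_surjective (Ideal.Quotient.lift _ g.toRingHom hg)
      (Ideal.Quotient.lift_surjective_of_surjective _ _ fun p => ⟨rename Subtype.val p, ?_⟩)
    have : g.comp (rename Subtype.val) = AlgHom.id k (MvPolynomial F k) := by
      ext i
      simp [g]
    exact DFunLike.congr_fun this p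

lemma ringKrullDim_quotient_srIdeal [Fintype V] {Δ : Set (Finset V)}
    (hΔ : IsSimplicialComplex Δ) {N : ℕ} (hle : ∀ F ∈ Δ, F.card ≤ N)
    (hN : ∃ F ∈ Δ, F.card = N) :
    ringKrullDim (MvPolynomial V k ⧸ srIdeal k Δ) = N := by
  apply le_antisymm
  · rw [ringKrullDim_quotient]
    refine iSup_le fun l => ?_
    have hl := l.head.2
    obtain ⟨F, hF, hFP⟩ := exists_facePrime_le (P := l.head.1.asIdeal) hl
    refine le_trans ?_ (Nat.cast_le.2 (hle F hF))
    rw [← ringKrullDim_quotient_facePrime (k := k) F, ringKrullDim_quotient]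
    let l' : LTSeries (PrimeSpectrum.zeroLocus (facePrime k F : Set (MvPolynomial V k))) :=
      { length := l.length
        toFun := fun i => ⟨(l i).1, hFP.trans (l.head_le i)⟩
        step := fun i => l.step i }
    exact Order.LTSeries.length_le_krullDim l'
  · obtain ⟨F, hF, rfl⟩ := hN
    rw [← ringKrullDim_quotient_facePrime (k := k) F]
    exact ringKrullDim_le_of_surjective _
      (Ideal.Quotient.factor_surjective (srIdeal_le_facePrime hΔ hF))

lemma card_sub_one_le_complexDim [Fintype V] {Δ : Set (Finset V)} {F : Finset V} (hF : F ∈ Δ) :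
    (F.card : ℤ) - 1 ≤ complexDim Δ :=
  le_csSup ((Set.toFinite Δ).image _).bddAbove ⟨F, hF, rfl⟩

lemma exists_card_sub_one_eq_complexDim [Fintype V] {Δ : Set (Finset V)} (hne : Δ.Nonempty) :
    ∃ F ∈ Δ, (F.card : ℤ) - 1 = complexDim Δ :=
  (hne.image _).csSup_mem ((Set.toFinite Δ).image _)

lemma complexDim_union [Fintype V] {Δ Γ : Set (Finset V)} (hΔ : Δ.Nonempty) (hΓ : Γ.Nonempty) :
    complexDim (Δ ∪ Γ) = max (complexDim Δ) (complexDim Γ) := by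
  rw [complexDim, Set.image_union]
  exact csSup_union ((Set.toFinite Δ).image _).bddAbove (hΔ.image _)
    ((Set.toFinite Γ).image _).bddAbove (hΓ.image _)

lemma ringKrullDim_quotient_srIdeal_of_complexDim [Fintype V] {Δ : Set (Finset V)}
    (hΔ : IsSimplicialComplex Δ) (hne : Δ.Nonempty) {N : ℕ} (hN : complexDim Δ = N - 1) :
    ringKrullDim (MvPolynomial V k ⧸ srIdeal k Δ) = N := by
  refine ringKrullDim_quotient_srIdeal hΔ (fun F hF => ?_) ?_
  · have := card_sub_one_le_complexDim hF
    omega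
  · obtain ⟨F, hF, h⟩ := exists_card_sub_one_eq_complexDim hne
    exact ⟨F, hF, by omega⟩

end StanleyReisner

section MayerVietoris

variable {R : Type} [CommRing R]

/-- The sequence `R ⧸ (I ⊓ J) → R ⧸ I × R ⧸ J → R ⧸ (I ⊔ J)`, the second map being the difference
of the projections. -/
def idealMayerVietoris (I J : Ideal R) : ShortComplex (ModuleCat.{0} R) :=
  ShortComplex.mk
    (X₁ := ModuleCat.of R (R ⧸ (I ⊓ J))) (X₂ := ModuleCat.of R ((R ⧸ I) × (R ⧸ J)))
    (X₃ := ModuleCat.of R (R ⧸ (I ⊔ J)))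
    (ModuleCat.ofHom ((Submodule.factor inf_le_left).prod (Submodule.factor inf_le_right)))
    (ModuleCat.ofHom ((Submodule.factor le_sup_left).comp (LinearMap.fst R _ _) -
      (Submodule.factor le_sup_right).comp (LinearMap.snd R _ _)))
    (by
      refine ModuleCat.hom_ext (LinearMap.ext fun x => ?_)
      obtain ⟨x, rfl⟩ := Submodule.Quotient.mk_surjective _ x
      exact sub_self (Submodule.Quotient.mk x : R ⧸ (I ⊔ J)))

lemma idealMayerVietoris_shortExact (I J : Ideal R) : (idealMayerVietoris I J).ShortExact where
  exact := by
    rw [ShortComplex.moduleCat_exact_iff]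
    rintro ⟨a, b⟩ hab
    obtain ⟨a, rfl⟩ := Submodule.Quotient.mk_surjective _ a
    obtain ⟨b, rfl⟩ := Submodule.Quotient.mk_surjective _ b
    have h : a - b ∈ I ⊔ J := (Submodule.Quotient.eq _).1 (sub_eq_zero.1 hab)
    obtain ⟨x, hx, y, hy, hxy⟩ := Submodule.mem_sup.1 h
    refine ⟨Submodule.Quotient.mk (a - x), Prod.ext ?_ ?_⟩
    · exact (Submodule.Quotient.eq _).2 (by simpa using hx)
    · refine (Submodule.Quotient.eq _).2 ?_
      have : a - x - b = y := by linear_combination hxy.symm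
      exact this.symm ▸ hy
  mono_f := by
    rw [ModuleCat.mono_iff_injective, injective_iff_map_eq_zero]
    intro x hx
    obtain ⟨x, rfl⟩ := Submodule.Quotient.mk_surjective _ x
    exact (Submodule.Quotient.mk_eq_zero _).2
      ⟨(Submodule.Quotient.mk_eq_zero _).1 (congrArg Prod.fst hx),
        (Submodule.Quotient.mk_eq_zero _).1 (congrArg Prod.snd hx)⟩
  epi_g := by
    rw [ModuleCat.epi_iff_surjective]
    intro x
    obtain ⟨x, rfl⟩ := Submodule.Quotient.mk_surjective _ x
    exact ⟨(Submodule.Quotient.mk x, 0), by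
      change (Submodule.Quotient.mk x : R ⧸ (I ⊔ J)) - Submodule.factor le_sup_right 0 = _
      rw [map_zero, sub_zero]⟩

end MayerVietoris

/-- **Lemma (Hibi).** If `Δ` and `Γ` are Cohen–Macaulay simplicial complexes of the same
dimension `d` on `[n]` and `Δ ∩ Γ` is Cohen–Macaulay of dimension `d`, then `Δ ∪ Γ` is
Cohen–Macaulay of dimension `d`. -/
theorem cm_union_of_cm_inter_same_dim {n : ℕ} (Δ Γ : Set (Finset (Fin n)))
    (hΔ : IsSimplicialComplex Δ) (hΓ : IsSimplicialComplex Γ)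
    (hΔne : Δ.Nonempty) (hΓne : Γ.Nonempty) (d : ℤ)
    (hdΔ : complexDim Δ = d) (hdΓ : complexDim Γ = d)
    (hcmΔ : complexCM Δ) (hcmΓ : complexCM Γ)
    (hcmInter : complexCM (Δ ∩ Γ)) (hdInter : complexDim (Δ ∩ Γ) = d) :
    complexCM (Δ ∪ Γ) ∧ complexDim (Δ ∪ Γ) = d := by
  have hΔ0 : ∅ ∈ Δ := hΔ _ hΔne.some_mem _ (Finset.empty_subset _)
  have hΓ0 : ∅ ∈ Γ := hΓ _ hΓne.some_mem _ (Finset.empty_subset _)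
  have hdUnion : complexDim (Δ ∪ Γ) = d := by
    rw [complexDim_union hΔne hΓne, hdΔ, hdΓ, max_self]
  refine ⟨fun k _ i hi => ?_, hdUnion⟩
  obtain ⟨F, -, hF⟩ := exists_card_sub_one_eq_complexDim hΔne
  rw [hdΔ] at hF
  rw [ringKrullDim_quotient_srIdeal_of_complexDim (hΔ.union hΓ) ⟨∅, Or.inl hΔ0⟩
    (hdUnion.trans hF.symm)] at hi
  have h₁ := hcmΔ k i (by
    rwa [ringKrullDim_quotient_srIdeal_of_complexDim hΔ hΔne (hdΔ.trans hF.symm)])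
  have h₂ := hcmΓ k i (by
    rwa [ringKrullDim_quotient_srIdeal_of_complexDim hΓ hΓne (hdΓ.trans hF.symm)])
  have h₃ (j : ℕ) (hj : j + 1 = i) := hcmInter k j (by
    rw [ringKrullDim_quotient_srIdeal_of_complexDim (hΔ.inter hΓ) ⟨∅, hΔ0, hΓ0⟩
      (hdInter.trans hF.symm)]
    refine lt_of_le_of_lt ?_ hi
    exact_mod_cast (by omega : j ≤ i))
  unfold locCoh at *
  rw [srIdeal_inter] at h₃
  rw [srIdeal_union hΔ hΓ]
  rw [subsingleton_localCohomology_iff] at h₁ h₂ ⊢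
  exact CocyclesVanish.of_shortExact (idealMayerVietoris_shortExact _ _) (h₁.prod h₂)
    fun j hj => (subsingleton_localCohomology_iff _ _ _).1 (h₃ j hj)
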